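/- Let p be the density of the symmetric stable distribution on ℝ with characteristic function exp(−|t|^r), where 1<r<2. Then p is continuous, p(x) > 0 for all x ∈ ℝ, and there exist constants c₁>0 and c₂>0 such that p(x) ≥ c₁ |x|^{−r−1} for all |x| ≥ c₂. -/

import Mathlib

open MeasureTheory Filter Set
open scoped Topology Real

noncomputable section

/-- the density of the symmetric stable distribution with characteristic
function `exp(−|t|^r)`:  `p(x) = (2π)⁻¹ ∫ e^{−itx} exp(−|t|^r) dt`
(a real number, written via the cosine since the integrand is even). -/
def stableDens (r : ℝ) (x : ℝ) : ℝ :=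
  (1 / (2 * Real.pi)) * ∫ t : ℝ, Real.cos (t * x) * Real.exp (-|t| ^ r)

/-- The cosine transform of `f` with respect to the measure `μ`. -/
def cosTransform (μ : Measure ℝ) (f : ℝ → ℝ) (x : ℝ) : ℝ :=
  ∫ t, Real.cos (t * x) * f t ∂μ

section CosTransform

variable {μ : Measure ℝ} {f g : ℝ → ℝ}

lemma integrable_cos_mul (hf : Integrable f μ) (x : ℝ) :
    Integrable (fun t => Real.cos (t * x) * f t) μ :=
  hf.bdd_mul (c := 1) (by fun_prop) (ae_of_all _ fun t => Real.abs_cos_le_one _)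

lemma norm_cos_mul_le (a y : ℝ) : ‖Real.cos a * y‖ ≤ ‖y‖ := by
  rw [norm_mul]
  exact mul_le_of_le_one_left (norm_nonneg _) (Real.abs_cos_le_one _)

lemma continuous_cosTransform (hf : Integrable f μ) : Continuous (cosTransform μ f) := by
  refine continuous_of_dominated (bound := fun t => ‖f t‖)
    (fun x => (integrable_cos_mul hf x).aestronglyMeasurable)
    (fun x => ae_of_all _ fun t => norm_cos_mul_le _ _) hf.norm (ae_of_all _ fun t => ?_)
  fun_prop

lemma norm_cosTransform_le (hf : Integrable f μ) (x : ℝ) :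
    ‖cosTransform μ f x‖ ≤ ∫ t, ‖f t‖ ∂μ :=
  norm_integral_le_of_norm_le hf.norm (ae_of_all _ fun _ => norm_cos_mul_le _ _)

lemma cosTransform_neg (f : ℝ → ℝ) (x : ℝ) : cosTransform μ f (-x) = cosTransform μ f x := by
  simp [cosTransform]

lemma cosTransform_abs (f : ℝ → ℝ) (x : ℝ) : cosTransform μ f |x| = cosTransform μ f x := by
  rcases abs_choice x with h | h <;> rw [h]
  exact cosTransform_neg f x

lemma integrable_mul_cosTransform (hf : Integrable f) (hg : Integrable g μ) :
    Integrable (fun t => f t * cosTransform μ g t) := by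
  simp_rw [mul_comm (f _)]
  exact hf.bdd_mul (continuous_cosTransform hg).aestronglyMeasurable
    (ae_of_all _ fun t => norm_cosTransform_le hg t)

lemma cosTransform_mul_cosTransform [SFinite μ] (hf : Integrable f) (hg : Integrable g μ)
    (x : ℝ) :
    cosTransform volume (fun t => f t * cosTransform μ g t) x =
      ∫ y, (cosTransform volume f (x - y) + cosTransform volume f (x + y)) / 2 * g y ∂μ := by
  have hint : Integrable (Function.uncurry fun t y : ℝ =>
      Real.cos (t * x) * (Real.cos (y * t) * (f t * g y))) (volume.prod μ) := by
    refine Integrable.bdd_mul (c := 1) ?_ (by fun_prop)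
      (ae_of_all _ fun t => Real.abs_cos_le_one _)
    exact (hf.mul_prod hg).bdd_mul (c := 1) (by fun_prop)
      (ae_of_all _ fun t => Real.abs_cos_le_one _)
  calc cosTransform volume (fun t => f t * cosTransform μ g t) x
      = ∫ t, ∫ y, Real.cos (t * x) * (Real.cos (y * t) * (f t * g y)) ∂μ := by
        refine integral_congr_ae (ae_of_all _ fun t => ?_)
        simp only [cosTransform, ← integral_const_mul]
        refine integral_congr_ae (ae_of_all _ fun y => ?_)
        ring
    _ = ∫ y, (∫ t, Real.cos (t * x) * (Real.cos (y * t) * (f t * g y))) ∂μ :=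
        integral_integral_swap hint
    _ = _ := by
        refine integral_congr_ae (ae_of_all _ fun y => ?_)
        simp only [cosTransform]
        rw [← integral_add (integrable_cos_mul hf _) (integrable_cos_mul hf _),
          ← integral_div, ← integral_mul_const]
        refine integral_congr_ae (ae_of_all _ fun t => ?_)
        simp only [mul_sub, mul_add, Real.cos_sub, Real.cos_add, mul_comm y t]
        ring

end CosTransform

/-- Integrable functions whose cosine transform is nonnegative. -/
structure HasNonnegCosTransform (f : ℝ → ℝ) : Prop where
  integrable : Integrable f
  nonneg : ∀ x, 0 ≤ cosTransform volume f x

namespace HasNonnegCosTransform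

variable {μ : Measure ℝ} {f g : ℝ → ℝ}

lemma gaussian {s : ℝ} (hs : 0 < s) :
    HasNonnegCosTransform fun t => Real.exp (-s * t ^ 2) := by
  refine ⟨integrable_exp_neg_mul_sq hs, fun x => ?_⟩
  have key := congrArg Complex.re (fourierIntegral_gaussian (b := (s : ℂ)) (by simpa) (x : ℂ))
  have hre : ∀ t : ℝ, Complex.exp (Complex.I * x * t) * Complex.exp (-s * t ^ 2) =
      Complex.exp ((t * x : ℝ) * Complex.I) * (Real.exp (-s * t ^ 2) : ℝ) := fun t => by
    push_cast
    ring_nf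
  have hint : Integrable fun t : ℝ =>
      Complex.exp ((t * x : ℝ) * Complex.I) * (Real.exp (-s * t ^ 2) : ℝ) :=
    ((integrable_exp_neg_mul_sq hs).ofReal).bdd_mul (c := 1)
      (by fun_prop) (ae_of_all _ fun t => (Complex.norm_exp_ofReal_mul_I _).le)
  simp_rw [hre] at key
  have hswap := integral_re hint
  simp only [RCLike.re_to_complex] at hswap
  rw [← hswap] at key
  have hleft : cosTransform volume (fun t => Real.exp (-s * t ^ 2)) x =
      ((π / s : ℂ) ^ (1 / 2 : ℂ) * Complex.exp (-x ^ 2 / (4 * s))).re := by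
    rw [← key]
    refine integral_congr_ae (ae_of_all _ fun t => ?_)
    simp only [Complex.re_mul_ofReal, Complex.exp_ofReal_mul_I_re]
  have hright : (π / s : ℂ) ^ (1 / 2 : ℂ) * Complex.exp (-x ^ 2 / (4 * s)) =
      (((π / s) ^ (1 / 2 : ℝ) * Real.exp (-x ^ 2 / (4 * s)) : ℝ) : ℂ) := by
    rw [Complex.ofReal_mul, Complex.ofReal_cpow (by positivity)]
    push_cast
    rfl
  rw [hleft, hright, Complex.ofReal_re]
  positivity

lemma mul_cosTransform [SFinite μ] (hf : HasNonnegCosTransform f) (hg : Integrable g μ)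
    (hg0 : ∀ᵐ y ∂μ, 0 ≤ g y) :
    HasNonnegCosTransform fun t => f t * cosTransform μ g t := by
  refine ⟨integrable_mul_cosTransform hf.integrable hg, fun x => ?_⟩
  rw [cosTransform_mul_cosTransform hf.integrable hg]
  refine integral_nonneg_of_ae (hg0.mono fun y hy => ?_)
  have h₁ := hf.nonneg (x - y)
  have h₂ := hf.nonneg (x + y)
  exact mul_nonneg (by linarith) hy

lemma mul_cosTransform_pow [SFinite μ] (hf : HasNonnegCosTransform f) (hg : Integrable g μ)
    (hg0 : ∀ᵐ y ∂μ, 0 ≤ g y) (k : ℕ) :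
    HasNonnegCosTransform fun t => f t * cosTransform μ g t ^ k := by
  induction k with
  | zero => simpa using hf
  | succ k ih => simpa only [pow_succ, mul_assoc] using ih.mul_cosTransform hg hg0

lemma const_mul (hf : HasNonnegCosTransform f) {c : ℝ} (hc : 0 ≤ c) :
    HasNonnegCosTransform fun t => c * f t := by
  refine ⟨hf.integrable.const_mul c, fun x => ?_⟩
  have h : cosTransform volume (fun t => c * f t) x = c * cosTransform volume f x := by
    simp only [cosTransform, ← integral_const_mul, mul_left_comm]
  rw [h]
  exact mul_nonneg hc (hf.nonneg x)

lemma of_tendsto {F : ℕ → ℝ → ℝ} {bound : ℝ → ℝ} (hF : ∀ n, HasNonnegCosTransform (F n))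
    (hbound : Integrable bound) (hle : ∀ n t, ‖F n t‖ ≤ bound t)
    (hlim : ∀ t, Tendsto (fun n => F n t) atTop (𝓝 (f t))) : HasNonnegCosTransform f := by
  refine ⟨hbound.mono' (aestronglyMeasurable_of_tendsto_ae atTop
    (fun n => (hF n).integrable.aestronglyMeasurable) (ae_of_all _ hlim))
    (ae_of_all _ fun t => le_of_tendsto (hlim t).norm (Eventually.of_forall fun n => hle n t)),
    fun x => ?_⟩
  have h : Tendsto (fun n => cosTransform volume (F n) x) atTop
      (𝓝 (cosTransform volume f x)) :=
    tendsto_integral_of_dominated_convergence bound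
      (fun n => (integrable_cos_mul (hF n).integrable x).aestronglyMeasurable) hbound
      (fun n => ae_of_all _ fun t => (norm_cos_mul_le _ _).trans (hle n t))
      (ae_of_all _ fun t => (hlim t).const_mul _)
  exact ge_of_tendsto' h fun n => (hF n).nonneg x

end HasNonnegCosTransform

section Exp

variable {μ : Measure ℝ} {f g : ℝ → ℝ}

lemma integrable_mul_exp_cosTransform (hf : Integrable f) (hg : Integrable g μ) :
    Integrable (fun t => f t * Real.exp (cosTransform μ g t)) := by
  simp_rw [mul_comm (f _)]
  refine hf.bdd_mul (c := Real.exp (∫ t, ‖g t‖ ∂μ))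
    (Real.continuous_exp.comp (continuous_cosTransform hg)).aestronglyMeasurable
    (ae_of_all _ fun t => ?_)
  rw [Real.norm_eq_abs, Real.abs_exp, Real.exp_le_exp]
  exact (Real.le_norm_self _).trans (norm_cosTransform_le hg t)

lemma Real.hasSum_pow_div_factorial (x : ℝ) :
    HasSum (fun k : ℕ => x ^ k / k.factorial) (Real.exp x) := by
  rw [Real.exp_eq_exp_ℝ]
  exact NormedSpace.expSeries_div_hasSum_exp x

lemma hasSum_cosTransform_mul_pow (hf : Integrable f) (hg : Integrable g μ) (x : ℝ) :
    HasSum (fun k : ℕ => cosTransform volume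
        (fun t => (1 / k.factorial : ℝ) * (f t * cosTransform μ g t ^ k)) x)
      (cosTransform volume (fun t => f t * Real.exp (cosTransform μ g t)) x) := by
  set L := ∫ t, ‖g t‖ ∂μ
  refine hasSum_integral_of_dominated_convergence (fun k t => ‖f t‖ * (L ^ k / k.factorial))
    (fun k => ?_) (fun k => ae_of_all _ fun t => (norm_cos_mul_le _ _).trans ?_)
    (ae_of_all _ fun t => (Real.summable_pow_div_factorial L).mul_left _) ?_
    (ae_of_all _ fun t => ?_)
  · have h₁ := hf.aestronglyMeasurable
    have h₂ := continuous_cosTransform hg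
    have h₃ := (h₂.pow k).aestronglyMeasurable (μ := volume)
    exact (by fun_prop : AEStronglyMeasurable (fun t => Real.cos (t * x)) volume).mul
      ((h₁.mul h₃).const_mul _)
  · rw [norm_mul, norm_mul, norm_pow]
    have h := pow_le_pow_left₀ (norm_nonneg _) (norm_cosTransform_le hg t) k
    have h₁ : ‖(1 / k.factorial : ℝ)‖ = 1 / k.factorial := by
      rw [Real.norm_of_nonneg (by positivity)]
    rw [h₁]
    calc (1 / k.factorial : ℝ) * (‖f t‖ * ‖cosTransform μ g t‖ ^ k)
        ≤ (1 / k.factorial : ℝ) * (‖f t‖ * L ^ k) := by gcongr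
      _ = ‖f t‖ * (L ^ k / k.factorial) := by ring
  · simp_rw [tsum_mul_left]
    exact hf.norm.mul_const _
  · have hterm : (fun k : ℕ => Real.cos (t * x) *
        ((1 / k.factorial : ℝ) * (f t * cosTransform μ g t ^ k))) = fun k : ℕ =>
        Real.cos (t * x) * f t * (cosTransform μ g t ^ k / k.factorial) := by
      funext k
      ring
    beta_reduce
    rw [hterm, ← mul_assoc]
    exact (Real.hasSum_pow_div_factorial (cosTransform μ g t)).mul_left _

lemma HasNonnegCosTransform.mul_exp_cosTransform [SFinite μ] (hf : HasNonnegCosTransform f)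
    (hg : Integrable g μ) (hg0 : ∀ᵐ y ∂μ, 0 ≤ g y) :
    HasNonnegCosTransform fun t => f t * Real.exp (cosTransform μ g t) :=
  ⟨integrable_mul_exp_cosTransform hf.integrable hg, fun x =>
    (hasSum_cosTransform_mul_pow hf.integrable hg x).nonneg fun k =>
      ((hf.mul_cosTransform_pow hg hg0 k).const_mul (by positivity)).nonneg x⟩

lemma HasNonnegCosTransform.cosTransform_mul_le_mul_exp [SFinite μ]
    (hf : HasNonnegCosTransform f) (hg : Integrable g μ) (hg0 : ∀ᵐ y ∂μ, 0 ≤ g y) (x : ℝ) :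
    cosTransform volume (fun t => f t * cosTransform μ g t) x ≤
      cosTransform volume (fun t => f t * Real.exp (cosTransform μ g t)) x := by
  simpa using le_hasSum (hasSum_cosTransform_mul_pow hf.integrable hg x) 1 fun k _ =>
    ((hf.mul_cosTransform_pow hg hg0 k).const_mul (by positivity)).nonneg x

end Exp

section LevyExponent

lemma hasNonnegCosTransform_exp_neg_levyExponent {h ψ : ℝ → ℝ} (h0 : ∀ y, 0 < y → 0 ≤ h y)
    (hint : ∀ a, 0 < a → IntegrableOn h (Ioi a))
    (hψint : ∀ t, IntegrableOn (fun y => (1 - Real.cos (y * t)) * h y) (Ioi 0))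
    (hψ : ∀ t, ψ t = ∫ y in Ioi 0, (1 - Real.cos (y * t)) * h y)
    (hexp : Integrable fun t => Real.exp (-ψ t)) :
    HasNonnegCosTransform fun t => Real.exp (-ψ t) := by
  have hnn : ∀ t y, 0 < y → 0 ≤ (1 - Real.cos (y * t)) * h y := fun t y hy =>
    mul_nonneg (sub_nonneg.2 (Real.cos_le_one _)) (h0 y hy)
  let a : ℕ → ℝ := fun n => 1 / ((n : ℝ) + 1)
  have ha : ∀ n, 0 < a n := fun n => by positivity
  let ψtrunc : ℕ → ℝ → ℝ := fun n t => ∫ y in Ioi (a n), (1 - Real.cos (y * t)) * h y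
  have hψtrunc0 : ∀ n t, 0 ≤ ψtrunc n t := fun n t =>
    setIntegral_nonneg measurableSet_Ioi fun y hy => hnn t y ((ha n).trans hy)
  have hψtrunc_lim : ∀ t, Tendsto (fun n => ψtrunc n t) atTop (𝓝 (ψ t)) := fun t => by
    have hU : ⋃ n, Ioi (a n) = Ioi (0 : ℝ) := by
      ext y
      simp only [mem_iUnion, mem_Ioi]
      exact ⟨fun ⟨n, hn⟩ => (ha n).trans hn, fun hy => exists_nat_one_div_lt hy⟩
    have hmono : Monotone fun n => Ioi (a n) := fun m n hmn =>
      Ioi_subset_Ioi (Nat.one_div_le_one_div hmn)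
    have := tendsto_setIntegral_of_monotone (μ := volume)
      (f := fun y => (1 - Real.cos (y * t)) * h y) (fun n => measurableSet_Ioi) hmono
      (by rw [hU]; exact hψint t)
    rwa [hU, ← hψ] at this
  have htrunc : ∀ s, 0 < s → ∀ n,
      HasNonnegCosTransform fun t => Real.exp (-s * t ^ 2) * Real.exp (-ψtrunc n t) := by
    intro s hs n
    have hh := hint (a n) (ha n)
    have h1 := ((HasNonnegCosTransform.gaussian hs).mul_exp_cosTransform hh
      ((ae_restrict_iff' measurableSet_Ioi).2
        (ae_of_all _ fun y hy => h0 y ((ha n).trans hy)))).const_mul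
      (Real.exp_pos (-∫ y in Ioi (a n), h y)).le
    convert h1 using 2 with t
    have hψtrunc : ψtrunc n t = (∫ y in Ioi (a n), h y) -
        cosTransform (volume.restrict (Ioi (a n))) h t := by
      simp only [ψtrunc, cosTransform, sub_mul, one_mul]
      exact integral_sub hh (integrable_cos_mul hh t)
    rw [hψtrunc, neg_sub, sub_eq_neg_add, Real.exp_add, mul_left_comm]
  have hgauss : ∀ s, 0 < s →
      HasNonnegCosTransform fun t => Real.exp (-s * t ^ 2) * Real.exp (-ψ t) := fun s hs => by
    refine .of_tendsto (htrunc s hs) (integrable_exp_neg_mul_sq hs) (fun n t => ?_) fun t =>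
      ((Real.continuous_exp.tendsto _).comp (hψtrunc_lim t).neg).const_mul _
    rw [Real.norm_of_nonneg (by positivity)]
    exact mul_le_of_le_one_right (by positivity) (Real.exp_le_one_iff.2 (by simpa using hψtrunc0 n t))
  refine .of_tendsto (fun n => hgauss (a n) (ha n)) hexp (fun n t => ?_) fun t => ?_
  · rw [Real.norm_of_nonneg (by positivity)]
    refine mul_le_of_le_one_left (by positivity) (Real.exp_le_one_iff.2 ?_)
    have := mul_nonneg (ha n).le (sq_nonneg t)
    linarith
  · have hlim : Tendsto (fun n => -a n * t ^ 2) atTop (𝓝 0) := by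
      simpa [a] using (tendsto_one_div_add_atTop_nhds_zero_nat (𝕜 := ℝ)).neg.mul_const (t ^ 2)
    simpa using ((Real.continuous_exp.tendsto _).comp hlim).mul_const (Real.exp (-ψ t))

variable {r : ℝ}

lemma integrableOn_one_sub_cos_mul_rpow (hr0 : 0 < r) (hr2 : r < 2) (t : ℝ) :
    IntegrableOn (fun y => (1 - Real.cos (y * t)) * y ^ (-r - 1)) (Ioi 0) := by
  have hmeas : Measurable fun y : ℝ => (1 - Real.cos (y * t)) * y ^ (-r - 1) := by fun_prop
  rw [← Ioc_union_Ioi_eq_Ioi zero_le_one]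
  refine IntegrableOn.union ?_ ?_
  · have hb : IntegrableOn (fun y : ℝ => t ^ 2 / 2 * y ^ (1 - r)) (Ioc 0 1) :=
      ((intervalIntegrable_iff_integrableOn_Ioc_of_le zero_le_one).1
        (intervalIntegral.intervalIntegrable_rpow' (by linarith))).const_mul _
    refine hb.mono' hmeas.aestronglyMeasurable
      ((ae_restrict_iff' measurableSet_Ioc).2 (ae_of_all _ fun y hy => ?_))
    have hy0 : 0 < y := hy.1
    have hcos := Real.one_sub_sq_div_two_le_cos (x := y * t)
    rw [Real.norm_of_nonneg (mul_nonneg (sub_nonneg.2 (Real.cos_le_one _)) (by positivity))]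
    calc (1 - Real.cos (y * t)) * y ^ (-r - 1)
        ≤ t ^ 2 / 2 * y ^ (2 : ℝ) * y ^ (-r - 1) := by
          gcongr
          rw [Real.rpow_two]
          linarith
      _ = t ^ 2 / 2 * y ^ (1 - r) := by
          rw [mul_assoc, ← Real.rpow_add hy0]
          ring_nf
  · have hb : IntegrableOn (fun y : ℝ => 2 * y ^ (-r - 1)) (Ioi 1) :=
      (integrableOn_Ioi_rpow_of_lt (by linarith) one_pos).const_mul _
    refine hb.mono' hmeas.aestronglyMeasurable
      ((ae_restrict_iff' measurableSet_Ioi).2 (ae_of_all _ fun y hy => ?_))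
    have hy0 : 0 < y := one_pos.trans hy
    rw [Real.norm_of_nonneg (mul_nonneg (sub_nonneg.2 (Real.cos_le_one _)) (by positivity))]
    gcongr
    linarith [Real.neg_one_le_cos (y * t)]

lemma integral_one_sub_cos_mul_rpow (hr0 : 0 < r) (t : ℝ) :
    ∫ y in Ioi 0, (1 - Real.cos (y * t)) * y ^ (-r - 1) =
      |t| ^ r * ∫ y in Ioi 0, (1 - Real.cos y) * y ^ (-r - 1) := by
  rcases eq_or_ne t 0 with rfl | ht
  · simp [Real.zero_rpow hr0.ne']
  have ht' : 0 < |t| := abs_pos.2 ht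
  have hscale := integral_comp_mul_left_Ioi
    (fun y : ℝ => (1 - Real.cos y) * y ^ (-r - 1)) 0 ht'
  rw [mul_zero, smul_eq_mul] at hscale
  have hpt : ∀ y ∈ Ioi (0 : ℝ), (1 - Real.cos (y * t)) * y ^ (-r - 1) =
      |t| ^ (r + 1) * ((1 - Real.cos (|t| * y)) * (|t| * y) ^ (-r - 1)) := fun y hy => by
    have hcos : Real.cos (|t| * y) = Real.cos (y * t) := by
      rw [← Real.cos_abs (y * t), abs_mul, abs_of_pos (mem_Ioi.1 hy), mul_comm]
    rw [hcos, Real.mul_rpow ht'.le (le_of_lt hy), mul_left_comm, ← mul_assoc (|t| ^ (r + 1)),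
      ← Real.rpow_add ht']
    simp
  rw [setIntegral_congr_fun measurableSet_Ioi hpt, integral_const_mul, hscale, ← mul_assoc,
    Real.rpow_add_one ht'.ne']
  field_simp

lemma integral_one_sub_cos_mul_rpow_pos (hr0 : 0 < r) (hr2 : r < 2) :
    0 < ∫ y in Ioi 0, (1 - Real.cos y) * y ^ (-r - 1) := by
  have hint : IntegrableOn (fun y => (1 - Real.cos y) * y ^ (-r - 1)) (Ioi 0) := by
    simpa using integrableOn_one_sub_cos_mul_rpow hr0 hr2 1
  rw [setIntegral_pos_iff_support_of_nonneg_ae ((ae_restrict_iff' measurableSet_Ioi).2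
    (ae_of_all _ fun y hy => mul_nonneg (sub_nonneg.2 (Real.cos_le_one _))
      (Real.rpow_nonneg (le_of_lt hy) _))) hint]
  refine lt_of_lt_of_le ?_ (measure_mono (s := Ioo 0 1) fun y hy => ⟨?_, hy.1⟩)
  · simp
  · have hcos : Real.cos y < 1 := by
      simpa using Real.cos_lt_cos_of_nonneg_of_le_pi le_rfl
        (hy.2.le.trans (by linarith [Real.pi_gt_three])) hy.1
    exact (mul_pos (sub_pos.2 hcos) (Real.rpow_pos_of_pos hy.1 _)).ne'

end LevyExponent

lemma integrable_exp_neg_abs_rpow {r : ℝ} (hr : 0 < r) :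
    Integrable fun t : ℝ => Real.exp (-|t| ^ r) := by
  have hIoi : IntegrableOn (fun t : ℝ => Real.exp (-|t| ^ r)) (Ioi 0) := by
    refine (integrableOn_rpow_mul_exp_neg_rpow (s := 0) (by norm_num) hr).congr_fun
      (fun t ht => ?_) measurableSet_Ioi
    simp [abs_of_pos (mem_Ioi.1 ht)]
  rw [← integrableOn_univ, ← Iic_union_Ioi (a := (0 : ℝ))]
  refine IntegrableOn.union ?_ hIoi
  rw [integrableOn_Iic_iff_integrableOn_Iio]
  simpa using hIoi.comp_neg

section LowerBound

variable {r : ℝ}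

lemma exists_stableDens_lower_bound (hr0 : 0 < r) (hr2 : r < 2) :
    ∃ c, 0 < c ∧ ∀ x, c * (2 + |x|) ^ (-r - 1) ≤ stableDens r x := by
  set K := ∫ y in Ioi 0, (1 - Real.cos y) * y ^ (-r - 1) with hK
  have hK0 : 0 < K := integral_one_sub_cos_mul_rpow_pos hr0 hr2
  set μ : Measure ℝ := volume.restrict (Ioi 0)
  let g : ℝ → ℝ := fun y => K⁻¹ * (y + 1) ^ (-r - 1)
  let h : ℝ → ℝ := fun y => K⁻¹ * y ^ (-r - 1) - g y
  have hg : Integrable g μ :=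
    (integrableOn_add_rpow_Ioi_of_lt (by linarith) (by norm_num)).const_mul _
  have hg0 : ∀ᵐ y ∂μ, 0 ≤ g y :=
    (ae_restrict_iff' measurableSet_Ioi).2 (ae_of_all _ fun y hy => by
      have hy' : 0 < y := hy
      positivity)
  have hh0 : ∀ y, 0 < y → 0 ≤ h y := fun y hy => sub_nonneg.2 (by
    have := Real.rpow_le_rpow_of_nonpos hy (by linarith : y ≤ y + 1) (by linarith : -r - 1 ≤ 0)
    simp only [g]
    gcongr)
  have hhint : ∀ a, 0 < a → IntegrableOn h (Ioi a) := fun a ha =>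
    ((integrableOn_Ioi_rpow_of_lt (by linarith) ha).const_mul _).sub
      (IntegrableOn.mono_set hg (Ioi_subset_Ioi ha.le))
  have hstable : ∀ t, IntegrableOn (fun y => K⁻¹ * ((1 - Real.cos (y * t)) * y ^ (-r - 1)))
      (Ioi 0) := fun t => (integrableOn_one_sub_cos_mul_rpow hr0 hr2 t).const_mul _
  have hgcos : ∀ t, IntegrableOn (fun y => g y - Real.cos (y * t) * g y) (Ioi 0) := fun t =>
    hg.sub (integrable_cos_mul hg t)
  have hsplit : ∀ t y, (1 - Real.cos (y * t)) * h y =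
      K⁻¹ * ((1 - Real.cos (y * t)) * y ^ (-r - 1)) - (g y - Real.cos (y * t) * g y) :=
    fun t y => by
      simp only [h]
      ring
  set Λ := ∫ y, g y ∂μ
  let ψ : ℝ → ℝ := fun t => |t| ^ r - (Λ - cosTransform μ g t)
  have hψ : ∀ t, ψ t = ∫ y in Ioi 0, (1 - Real.cos (y * t)) * h y := fun t => by
    simp_rw [hsplit]
    rw [integral_sub (hstable t) (hgcos t), integral_const_mul,
      integral_one_sub_cos_mul_rpow hr0, ← hK, integral_sub hg (integrable_cos_mul hg t),
      mul_left_comm, inv_mul_cancel₀ hK0.ne', mul_one]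
    rfl
  have hexp_int : Integrable fun t => Real.exp (-ψ t) := by
    have := ((integrable_mul_exp_cosTransform (integrable_exp_neg_abs_rpow hr0) hg.neg)).const_mul
      (Real.exp Λ)
    convert this using 2 with t
    have hneg : cosTransform μ (-g) t = -cosTransform μ g t := by
      simp [cosTransform, integral_neg]
    rw [hneg, ← Real.exp_add, ← Real.exp_add]
    congr 1
    simp only [ψ]
    ring
  have hQ : HasNonnegCosTransform fun t => Real.exp (-ψ t) :=
    hasNonnegCosTransform_exp_neg_levyExponent hh0 hhint
      (fun t => by simpa only [hsplit] using! (hstable t).sub (hgcos t)) hψ hexp_int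
  set Q := cosTransform volume fun t => Real.exp (-ψ t) with hQdef
  have hQcont : Continuous Q := continuous_cosTransform hexp_int
  have hQ0 : 0 < Q 0 := by
    simpa [hQdef, cosTransform] using integral_exp_pos hexp_int
  obtain ⟨δ, hδ, hδQ⟩ := Metric.eventually_nhds_iff.1
    (hQcont.continuousAt.eventually (lt_mem_nhds (half_lt_self hQ0)))
  let a := min δ 1
  have ha : 0 < a := lt_min hδ one_pos
  have hdens : ∀ x, stableDens r x = 1 / (2 * π) * (Real.exp (-Λ) * cosTransform volume
      (fun t => Real.exp (-ψ t) * Real.exp (cosTransform μ g t)) x) := fun x => by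
    simp only [stableDens, cosTransform.eq_1 volume, ← integral_const_mul (Real.exp (-Λ))]
    congr 2 with t
    rw [mul_left_comm, ← Real.exp_add, ← Real.exp_add]
    congr 2
    simp only [ψ]
    ring
  refine ⟨1 / (2 * π) * (Real.exp (-Λ) * (Q 0 / 4 * K⁻¹ * a)), by positivity, fun x => ?_⟩
  have hmass : Q 0 / 4 * (K⁻¹ * (2 + |x|) ^ (-r - 1)) * a ≤
      ∫ y, (Q (|x| - y) + Q (|x| + y)) / 2 * g y ∂μ := by
    have hint : Integrable (fun y => (Q (|x| - y) + Q (|x| + y)) / 2 * g y) μ := by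
      refine hg.bdd_mul (c := ∫ t, ‖Real.exp (-ψ t)‖) (by fun_prop) (ae_of_all _ fun y => ?_)
      have h₁ := norm_cosTransform_le hexp_int (|x| - y)
      have h₂ := norm_cosTransform_le hexp_int (|x| + y)
      rw [norm_div, Real.norm_ofNat, div_le_iff₀ two_pos]
      refine (norm_add_le _ _).trans ?_
      linarith
    have hsub : Ioo |x| (|x| + a) ⊆ Ioi 0 := fun y hy => (abs_nonneg x).trans_lt hy.1
    have hnonneg : 0 ≤ᵐ[μ] fun y => (Q (|x| - y) + Q (|x| + y)) / 2 * g y :=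
      hg0.mono fun y hy =>
        mul_nonneg (div_nonneg (add_nonneg (hQ.nonneg _) (hQ.nonneg _)) two_pos.le) hy
    refine le_trans ?_ (setIntegral_mono_set hint hnonneg hsub.eventuallyLE)
    have hlow := setIntegral_ge_of_const_le_real (μ := volume) (s := Ioo |x| (|x| + a))
      (c := Q 0 / 4 * (K⁻¹ * (2 + |x|) ^ (-r - 1))) measurableSet_Ioo (by simp)
      (fun y hy => ?_) (IntegrableOn.mono_set hint hsub)
    · simpa [ha.le] using hlow
    have hy0 : 0 < y := hsub hy
    have hdist : dist (|x| - y) 0 < δ := by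
      rw [Real.dist_0_eq_abs, abs_sub_comm, abs_of_pos (sub_pos.2 hy.1)]
      have := min_le_left δ 1
      linarith [hy.2]
    have hQ₁ := hδQ hdist
    have hQ₂ := hQ.nonneg (|x| + y)
    have hya : y + 1 ≤ 2 + |x| := by
      have := min_le_right δ 1
      linarith [hy.2]
    have hpow := Real.rpow_le_rpow_of_nonpos (by linarith : 0 < y + 1) hya
      (by linarith : -r - 1 ≤ 0)
    have hQ₃ : Q 0 / 4 ≤ (Q (|x| - y) + Q (|x| + y)) / 2 := by linarith
    have hQ₄ : 0 ≤ (Q (|x| - y) + Q (|x| + y)) / 2 := by linarith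
    simp only [g]
    gcongr
  have hconv := hQ.cosTransform_mul_le_mul_exp hg hg0 |x|
  rw [cosTransform_mul_cosTransform hexp_int hg, cosTransform_abs] at hconv
  rw [hdens]
  calc 1 / (2 * π) * (Real.exp (-Λ) * (Q 0 / 4 * K⁻¹ * a)) * (2 + |x|) ^ (-r - 1)
      = 1 / (2 * π) * (Real.exp (-Λ) * (Q 0 / 4 * (K⁻¹ * (2 + |x|) ^ (-r - 1)) * a)) := by ring
    _ ≤ _ := by
      gcongr
      exact hmass.trans hconv

end LowerBound

theorem stmt19 (r : ℝ) (hr1 : 1 < r) (hr2 : r < 2) :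
    Continuous (stableDens r) ∧
    (∀ x : ℝ, 0 < stableDens r x) ∧
    ∃ c₁ c₂ : ℝ, 0 < c₁ ∧ 0 < c₂ ∧
      ∀ x : ℝ, c₂ ≤ |x| → c₁ * |x| ^ (-r - 1) ≤ stableDens r x := by
  have hr0 : 0 < r := one_pos.trans hr1
  obtain ⟨c, hc, hlow⟩ := exists_stableDens_lower_bound hr0 hr2
  refine ⟨continuous_const.mul (continuous_cosTransform (integrable_exp_neg_abs_rpow hr0)),
    fun x => lt_of_lt_of_le (by positivity) (hlow x),
    c * 3 ^ (-r - 1), 1, by positivity, one_pos, fun x hx => le_trans ?_ (hlow x)⟩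
  rw [mul_assoc, ← Real.mul_rpow (by norm_num) (abs_nonneg x)]
  exact mul_le_mul_of_nonneg_left
    (Real.rpow_le_rpow_of_nonpos (by positivity) (by linarith) (by linarith)) hc.le
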